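/- Let T > 0, ρ ∈ (−1,1), ρ̄ := √(1−ρ²). Let K satisfy Assumption (K), let U : ℝ → [0,∞) be continuous, let σ : ℝ → (0,∞) be continuous, and let b̄, σ̄ satisfy Assumption (R) with fixed v₀ > 0. For r, f ∈ H₀¹[0,T] and a continuous v : [0,T] → ℝ with v(t) = v₀ + ∫₀^t b̄(v(s)) ds + ∫₀^t σ̄(v(s)) ḟ(s) ds for all t, set w(t) := ∫₀^t K(t,s) U(v(s)) ds, Φ(r,f,v)(t) := ρ̄ ∫₀^t σ(w(s)) ṙ(s) ds + ρ ∫₀^t σ(w(s)) ḟ(s) ds, and for m ≥ 1, with t_k := kT/m and Ξ_m(t) := (T/m)⌊mt/T⌋, Φ_m(r,f,v)(t) := ρ̄ ( Σ_{k=0}^{⌊mt/T⌋−1} σ(w(t_k)) (r(t_{k+1}) − r(t_k)) + σ(w(Ξ_m(t))) (r(t) − r(Ξ_m(t))) ) + ρ ( Σ_{k=0}^{⌊mt/T⌋−1} σ(w(t_k)) (f(t_{k+1}) − f(t_k)) + σ(w(Ξ_m(t))) (f(t) − f(Ξ_m(t))) ). Then for every ζ > 0, lim_{m→∞} sup { sup_{t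 ∈ [0,T]} |Φ(r,f,v)(t) − Φ_m(r,f,v)(t)| : r, f ∈ H₀¹[0,T], v as above, ½ ∫₀^T ṙ(s)² ds + ½ ∫₀^T ḟ(s)² ds ≤ ζ } = 0. -/

import Mathlib

open MeasureTheory Set

/-- `w(t) = ∫₀^t K(t,s) U(v(s)) ds`. -/
noncomputable def what (K : ℝ → ℝ → ℝ) (U : ℝ → ℝ) (v : ℝ → ℝ) (t : ℝ) : ℝ :=
  ∫ s in Icc (0:ℝ) t, K t s * U (v s)

/-- Pathwise `Φ(r,f,v)(t)` (with `ṙ = dr`, `ḟ = df`). -/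
noncomputable def PhiPath (ρ : ℝ) (K : ℝ → ℝ → ℝ) (U σ : ℝ → ℝ)
    (dr df v : ℝ → ℝ) (t : ℝ) : ℝ :=
  Real.sqrt (1 - ρ^2) * (∫ s in Icc (0:ℝ) t, σ (what K U v s) * dr s) +
    ρ * ∫ s in Icc (0:ℝ) t, σ (what K U v s) * df s

/-- `Ξ_m(t) = (T/m)⌊mt/T⌋`. -/
noncomputable def Xi (T : ℝ) (m : ℕ) (t : ℝ) : ℝ :=
  (T / m) * (⌊(m : ℝ) * t / T⌋₊ : ℝ)

/-- Pathwise discretization `Φ_m(r,f,v)(t)` with grid `t_k = kT/m`. -/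
noncomputable def PhimPath (T ρ : ℝ) (K : ℝ → ℝ → ℝ) (U σ : ℝ → ℝ) (m : ℕ)
    (r f v : ℝ → ℝ) (t : ℝ) : ℝ :=
  Real.sqrt (1 - ρ^2) *
      ((∑ k ∈ Finset.range ⌊(m : ℝ) * t / T⌋₊,
          σ (what K U v ((k : ℝ) * T / m)) * (r (((k : ℝ) + 1) * T / m) - r ((k : ℝ) * T / m))) +
        σ (what K U v (Xi T m t)) * (r t - r (Xi T m t))) +
    ρ *
      ((∑ k ∈ Finset.range ⌊(m : ℝ) * t / T⌋₊,
          σ (what K U v ((k : ℝ) * T / m)) * (f (((k : ℝ) + 1) * T / m) - f ((k : ℝ) * T / m))) +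
        σ (what K U v (Xi T m t)) * (f t - f (Xi T m t)))

lemma aux_cs {α : Type*} [MeasurableSpace α] (ν : Measure α) (h f g : α → ℝ)
    (hf : MemLp f 2 ν) (hg : MemLp g 2 ν) (hh : ∀ᵐ x ∂ν, |h x| ≤ |f x| * |g x|) :
    (∫ x, h x ∂ν)^2 ≤ (∫ x, (f x)^2 ∂ν) * (∫ x, (g x)^2 ∂ν) := by
  have hi : Integrable (fun x => |f x| * |g x|) ν := hf.norm.integrable_mul hg.norm
  have h1 : |∫ x, h x ∂ν| ≤ ∫ x, |f x| * |g x| ∂ν := by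
    rw [← Real.norm_eq_abs]
    exact norm_integral_le_of_norm_le hi hh
  have h2 := integral_mul_le_Lp_mul_Lq_of_nonneg (μ := ν) Real.HolderConjugate.two_two
    (f := fun x => |f x|) (g := fun x => |g x|)
    (Filter.Eventually.of_forall fun x => abs_nonneg _)
    (Filter.Eventually.of_forall fun x => abs_nonneg _)
    (by simpa using hf.norm) (by simpa using hg.norm)
  simp only [Real.rpow_two, sq_abs, ← Real.sqrt_eq_rpow] at h2
  have h3 := h1.trans h2
  have hF : 0 ≤ ∫ x, (f x)^2 ∂ν := integral_nonneg fun x => sq_nonneg _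
  have hG : 0 ≤ ∫ x, (g x)^2 ∂ν := integral_nonneg fun x => sq_nonneg _
  rw [← Real.sqrt_mul hF] at h3
  calc (∫ x, h x ∂ν)^2 = |∫ x, h x ∂ν|^2 := (sq_abs _).symm
    _ ≤ (Real.sqrt _)^2 := by gcongr
    _ = _ := Real.sq_sqrt (mul_nonneg hF hG)

lemma aux_gron (T A B : ℝ) (hA : 0 ≤ A) (hB : 0 ≤ B) (V : ℝ → ℝ) (hV : Continuous V)
    (h : ∀ t ∈ Icc (0:ℝ) T, 1 + (V t)^2 ≤ A + B * ∫ s in (0:ℝ)..t, (1 + (V s)^2)) :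
    ∀ t ∈ Icc (0:ℝ) T, 1 + (V t)^2 ≤ A + B * gronwallBound 0 B A T := by
  have hc : Continuous fun s => 1 + (V s)^2 := by fun_prop
  have hd : ∀ x, HasDerivAt (fun u => ∫ s in (0:ℝ)..u, (1 + (V s)^2)) (1 + (V x)^2) x :=
    fun x => hc.integral_hasStrictDerivAt 0 x |>.hasDerivAt
  intro t ht
  have hn : ∀ x ∈ Icc (0:ℝ) T, 0 ≤ ∫ s in (0:ℝ)..x, (1 + (V s)^2) := fun x hx =>
    intervalIntegral.integral_nonneg hx.1 fun _ _ => by positivity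
  have := norm_le_gronwallBound_of_norm_deriv_right_le (δ := 0) (K := B) (ε := A) (a := 0) (b := T)
    (f := fun u => ∫ s in (0:ℝ)..u, (1 + (V s)^2)) (f' := fun x => 1 + (V x)^2)
    (fun x _ => (hd x).continuousAt.continuousWithinAt)
    (fun x _ => (hd x).hasDerivWithinAt) (by simp)
    (fun x hx => by
      rw [Real.norm_of_nonneg (by positivity), Real.norm_of_nonneg (hn x ⟨hx.1, hx.2.le⟩)]
      linarith [h x ⟨hx.1, hx.2.le⟩]) t ht
  rw [Real.norm_of_nonneg (hn t ht)] at this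
  have hm := gronwallBound_mono (δ := 0) (K := B) (ε := A) le_rfl hA hB
    (show t - 0 ≤ T by linarith [ht.2])
  have := this.trans hm
  have h2 := h t ht
  nlinarith [mul_le_mul_of_nonneg_left this hB]

lemma aux_apriori (T : ℝ) (hT : 0 < T) (v₀ μ : ℝ) (ζ : ℝ) (hζ : 0 < ζ) (bb sb : ℝ → ℝ)
    (hbgrow : ∀ x : ℝ, (bb x)^2 ≤ μ^2 * (1 + x^2))
    (hsgrow : ∀ x : ℝ, (sb x)^2 ≤ μ^2 * (1 + x^2)) :
    ∃ C : ℝ, 0 ≤ C ∧ ∀ df v : ℝ → ℝ, Measurable df →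
      IntegrableOn (fun s => (df s)^2) (Icc (0:ℝ) T) →
      ContinuousOn v (Icc (0:ℝ) T) →
      (∀ t ∈ Icc (0:ℝ) T,
          v t = v₀ + (∫ s in Icc (0:ℝ) t, bb (v s)) + ∫ s in Icc (0:ℝ) t, sb (v s) * df s) →
      (∫ s in Icc (0:ℝ) T, (df s)^2) ≤ 2 * ζ → ∀ t ∈ Icc (0:ℝ) T, |v t| ≤ C := by
  set A := 1 + 3 * v₀^2
  set B := 3 * (μ^2 * T) + 3 * (μ^2 * (2 * ζ))
  have hA : 0 ≤ A := by positivity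
  have hB : 0 ≤ B := by positivity
  refine ⟨Real.sqrt (A + B * gronwallBound 0 B A T), Real.sqrt_nonneg _, ?_⟩
  intro df v hdf hdf2 hv heq hen
  set V := IccExtend hT.le ((Icc (0:ℝ) T).domRestrict v)
  have hVc : Continuous V := (continuousOn_iff_continuous_domRestrict.1 hv).Icc_extend'
  have hVe : ∀ t ∈ Icc (0:ℝ) T, V t = v t := fun t ht => by
    simp only [V]; rw [IccExtend_of_mem _ _ ht]; rfl
  have hg : ∀ t ∈ Icc (0:ℝ) T, 1 + (V t)^2 ≤ A + B * ∫ s in (0:ℝ)..t, (1 + (V s)^2) := by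
    intro t ht
    have hsub : Icc (0:ℝ) t ⊆ Icc 0 T := Icc_subset_Icc_right ht.2
    have hFeq : ∫ s in (0:ℝ)..t, (1 + (V s)^2) = ∫ s in Icc (0:ℝ) t, (1 + (V s)^2) := by
      rw [intervalIntegral.integral_of_le ht.1, integral_Icc_eq_integral_Ioc]
    set F := ∫ s in (0:ℝ)..t, (1 + (V s)^2)
    have hF0 : 0 ≤ F := intervalIntegral.integral_nonneg ht.1 fun _ _ => by positivity
    set ν := volume.restrict (Icc (0:ℝ) t)
    let G : ℝ → ℝ := fun s => |μ| * Real.sqrt (1 + (V s)^2)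
    have hGc : Continuous G := by fun_prop
    have hG2 : ∀ s, (G s)^2 = μ^2 * (1 + (V s)^2) := fun s => by
      simp only [G]; rw [mul_pow, sq_abs, Real.sq_sqrt (by positivity)]
    have hGn : ∀ s, 0 ≤ G s := fun s => by positivity
    have hGm : MemLp G 2 ν := by
      rw [memLp_two_iff_integrable_sq hGc.aestronglyMeasurable]
      exact (hGc.pow 2).continuousOn.integrableOn_Icc
    have hGi : ∫ s, (G s)^2 ∂ν = μ^2 * F := by
      simp_rw [hG2]; rw [integral_const_mul, hFeq]
    have hdm : MemLp df 2 ν := by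
      rw [memLp_two_iff_integrable_sq hdf.aestronglyMeasurable]
      exact hdf2.mono_set hsub
    have hle : ∀ (x : ℝ) (s : ℝ), s ∈ Icc 0 t → x^2 ≤ μ^2 * (1 + (v s)^2) → |x| ≤ |G s| := by
      intro x s hs hx
      apply sq_le_sq.1
      rw [hG2, hVe s (hsub hs)]
      exact hx
    have h1 := aux_cs ν (fun s => bb (v s)) G (fun _ => 1) hGm (memLp_const 1)
      ((ae_restrict_iff' measurableSet_Icc).2 <| .of_forall fun s hs => by
        simpa using hle _ s hs (hbgrow _))
    have h2 := aux_cs ν (fun s => sb (v s) * df s) G df hGm hdm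
      ((ae_restrict_iff' measurableSet_Icc).2 <| .of_forall fun s hs => by
        rw [abs_mul]
        exact mul_le_mul_of_nonneg_right (hle _ s hs (hsgrow _)) (abs_nonneg _))
    have h3 : ∫ s, (df s)^2 ∂ν ≤ 2 * ζ :=
      (setIntegral_mono_set hdf2 (.of_forall fun s => sq_nonneg _) hsub.eventuallyLE).trans hen
    have h4 : ∫ s, (1:ℝ)^2 ∂ν ≤ T := by
      simp [ν, ht.1, ht.2]
    rw [hGi] at h1 h2
    have hμF : 0 ≤ μ^2 * F := by positivity
    have h1' := h1.trans (mul_le_mul_of_nonneg_left h4 hμF)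
    have h2' := h2.trans (mul_le_mul_of_nonneg_left h3 hμF)
    rw [hVe t ht, heq t ht]
    generalize (∫ s in Icc (0:ℝ) t, bb (v s)) = x at *
    generalize (∫ s in Icc (0:ℝ) t, sb (v s) * df s) = y at *
    simp only [A, B]
    nlinarith [sq_nonneg (v₀ - x), sq_nonneg (v₀ - y), sq_nonneg (x - y)]
  intro t ht
  have := aux_gron T A B hA hB V hVc hg t ht
  rw [hVe t ht] at this
  apply Real.abs_le_sqrt
  linarith

/-- continuity of the Volterra transform -/
lemma aux_w (T : ℝ) (hT : 0 < T) (K : ℝ → ℝ → ℝ) (c cr : ℝ)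
    (hKmeas : Measurable (Function.uncurry K))
    (hKint : ∀ t ∈ Icc (0:ℝ) T, IntegrableOn (fun s => (K t s)^2) (Icc (0:ℝ) T))
    (CK : ℝ) (hKbdd : ∀ t ∈ Icc (0:ℝ) T, (∫ s in Icc (0:ℝ) T, (K t s)^2) ≤ CK)
    (hKmoc : ∀ t₁ ∈ Icc (0:ℝ) T, ∀ t₂ ∈ Icc (0:ℝ) T,
      (∫ s in Icc (0:ℝ) T, (K t₁ s - K t₂ s)^2) ≤ c * |t₁ - t₂| ^ cr)
    (hKvolterra : ∀ t s : ℝ, 0 ≤ t → t < s → s ≤ T → K t s = 0)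
    (U : ℝ → ℝ) (hUcont : Continuous U) (v : ℝ → ℝ) (hv : ContinuousOn v (Icc (0:ℝ) T))
    (M : ℝ) (hM : ∀ s ∈ Icc (0:ℝ) T, |U (v s)| ≤ M) :
    (∀ t ∈ Icc (0:ℝ) T, (what K U v t)^2 ≤ CK * (M^2 * T)) ∧
    (∀ t₁ ∈ Icc (0:ℝ) T, ∀ t₂ ∈ Icc (0:ℝ) T,
      (what K U v t₁ - what K U v t₂)^2 ≤ c * |t₁ - t₂| ^ cr * (M^2 * T)) := by
  set ν := volume.restrict (Icc (0:ℝ) T)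
  have hKm : ∀ t, Measurable (K t) := fun t => hKmeas.comp measurable_prodMk_left
  have hL : ∀ t ∈ Icc (0:ℝ) T, MemLp (K t) 2 ν := fun t ht => by
    rw [memLp_two_iff_integrable_sq (hKm t).aestronglyMeasurable]
    exact hKint t ht
  have hUL : MemLp (fun s => U (v s)) 2 ν := by
    have hc : ContinuousOn (fun s => U (v s)) (Icc (0:ℝ) T) := hUcont.comp_continuousOn hv
    rw [memLp_two_iff_integrable_sq (hc.aestronglyMeasurable measurableSet_Icc)]
    exact (hc.pow 2).integrableOn_Icc
  have hML : MemLp (fun _ : ℝ => M) 2 ν := memLp_const M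
  have hMi : ∫ s : ℝ, M^2 ∂ν = M^2 * T := by simp [ν, hT.le, mul_comm]
  have hw : ∀ t ∈ Icc (0:ℝ) T, what K U v t = ∫ s, K t s * U (v s) ∂ν := by
    intro t ht
    unfold what
    symm
    apply setIntegral_eq_of_subset_of_forall_sdiff_eq_zero measurableSet_Icc
      (Icc_subset_Icc_right ht.2)
    intro s hs
    have : t < s := by
      by_contra hcon
      exact hs.2 ⟨hs.1.1, not_lt.1 hcon⟩
    simp [hKvolterra t s ht.1 this hs.1.2]
  have hMn : 0 ≤ M^2 * T := by positivity
  have hae : ∀ (k : ℝ → ℝ), ∀ᵐ s ∂ν, |k s * U (v s)| ≤ |k s| * |M| := fun k =>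
    (ae_restrict_iff' measurableSet_Icc).2 <| .of_forall fun s hs => by
      rw [abs_mul]
      exact mul_le_mul_of_nonneg_left ((hM s hs).trans (le_abs_self M)) (abs_nonneg _)
  constructor
  · intro t ht
    rw [hw t ht]
    have := aux_cs ν (fun s => K t s * U (v s)) (K t) (fun _ => M) (hL t ht) hML (hae _)
    rw [hMi] at this
    exact this.trans (mul_le_mul_of_nonneg_right (hKbdd t ht) hMn)
  · intro t₁ h₁ t₂ h₂
    have i₁ : Integrable (fun s => K t₁ s * U (v s)) ν := (hL t₁ h₁).integrable_mul hUL
    have i₂ : Integrable (fun s => K t₂ s * U (v s)) ν := (hL t₂ h₂).integrable_mul hUL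
    rw [hw t₁ h₁, hw t₂ h₂, ← integral_sub i₁ i₂]
    simp_rw [← sub_mul]
    have := aux_cs ν (fun s => (K t₁ s - K t₂ s) * U (v s)) (fun s => K t₁ s - K t₂ s)
      (fun _ => M) ((hL t₁ h₁).sub (hL t₂ h₂)) hML (hae _)
    rw [hMi] at this
    exact this.trans (mul_le_mul_of_nonneg_right (hKmoc t₁ h₁ t₂ h₂) hMn)

/-- One path: Riemann-sum error estimate. -/
lemma aux_riemann (T : ℝ) (hT : 0 < T) (m : ℕ) (hm : 0 < m) (S g dg : ℝ → ℝ) (η : ℝ)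
    (hS : ContinuousOn S (Icc (0:ℝ) T))
    (hη : ∀ a ∈ Icc (0:ℝ) T, ∀ b ∈ Icc (0:ℝ) T, |a - b| ≤ T / m → |S a - S b| ≤ η)
    (hdg : IntegrableOn dg (Icc (0:ℝ) T))
    (hg : ∀ t ∈ Icc (0:ℝ) T, g t = ∫ s in Icc (0:ℝ) t, dg s) :
    ∀ t ∈ Icc (0:ℝ) T,
    |(∫ s in Icc (0:ℝ) t, S s * dg s) -
      ((∑ k ∈ Finset.range ⌊(m : ℝ) * t / T⌋₊,
          S ((k : ℝ) * T / m) * (g (((k : ℝ) + 1) * T / m) - g ((k : ℝ) * T / m))) +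
        S (Xi T m t) * (g t - g (Xi T m t)))| ≤ η * ∫ s in Icc (0:ℝ) T, |dg s| := by
  have hm' : (0:ℝ) < m := by exact_mod_cast hm
  have hconv : ∀ (φ : ℝ → ℝ) (t : ℝ), 0 ≤ t → ∫ s in Icc (0:ℝ) t, φ s = ∫ s in (0:ℝ)..t, φ s :=
    fun φ t ht => by rw [intervalIntegral.integral_of_le ht, integral_Icc_eq_integral_Ioc]
  have hSd : IntegrableOn (fun s => S s * dg s) (Icc (0:ℝ) T) :=
    hdg.continuousOn_mul hS isCompact_Icc
  have hii : ∀ φ : ℝ → ℝ, IntegrableOn φ (Icc (0:ℝ) T) → ∀ a ∈ Icc (0:ℝ) T, ∀ b ∈ Icc (0:ℝ) T,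
      IntervalIntegrable φ volume a b := fun φ hφ a ha b hb =>
    (hφ.mono_set (uIcc_subset_Icc ha hb)).intervalIntegrable
  have h0 : (0:ℝ) ∈ Icc (0:ℝ) T := ⟨le_rfl, hT.le⟩
  have hη0 : 0 ≤ η := (abs_nonneg _).trans (hη 0 h0 0 h0 (by simp; positivity))
  -- one step
  have hstep : ∀ a ∈ Icc (0:ℝ) T, ∀ b ∈ Icc (0:ℝ) T, a ≤ b → b - a ≤ T / m →
      |(∫ s in a..b, S s * dg s) - S a * (g b - g a)| ≤ η * ∫ s in a..b, |dg s| := by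
    intro a ha b hb hab hd
    rw [hg a ha, hg b hb, hconv _ _ ha.1, hconv _ _ hb.1,
      intervalIntegral.integral_interval_sub_left (hii _ hdg 0 h0 b hb) (hii _ hdg 0 h0 a ha),
      ← intervalIntegral.integral_const_mul, ← intervalIntegral.integral_const_mul,
      ← intervalIntegral.integral_sub (hii _ hSd a ha b hb) ((hii _ hdg a ha b hb).const_mul _)]
    rw [← Real.norm_eq_abs]
    apply intervalIntegral.norm_integral_le_of_norm_le hab
    · refine .of_forall fun s hs => ?_
      rw [← sub_mul, norm_mul]
      apply mul_le_mul_of_nonneg_right _ (abs_nonneg _)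
      apply hη s ⟨ha.1.trans hs.1.le, hs.2.trans hb.2⟩ a ha
      rw [abs_of_nonneg (by linarith [hs.1])]
      linarith [hs.2]
    · exact (hii _ hdg.abs a ha b hb).const_mul _
  have hgrid : ∀ n : ℕ, (n : ℝ) * T / m ≤ T → 
      |(∫ s in (0:ℝ)..((n : ℝ) * T / m), S s * dg s) - ∑ k ∈ Finset.range n,
          S ((k : ℝ) * T / m) * (g (((k : ℝ) + 1) * T / m) - g ((k : ℝ) * T / m))|
        ≤ η * ∫ s in (0:ℝ)..((n : ℝ) * T / m), |dg s| := by
    intro n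
    induction n with
    | zero => intro _; simp
    | succ n ih =>
      intro hn
      push_cast at hn ⊢
      have e : ((n:ℝ) + 1) * T / m - (n : ℝ) * T / m = T / m := by ring
      have hTm : 0 < T / m := by positivity
      have ha : (n : ℝ) * T / m ∈ Icc (0:ℝ) T := ⟨by positivity, by linarith⟩
      have hb : ((n:ℝ) + 1) * T / m ∈ Icc (0:ℝ) T := ⟨by positivity, hn⟩
      have h1 := ih ha.2
      have h2 := hstep _ ha _ hb (by linarith) e.le
      rw [Finset.sum_range_succ, ← intervalIntegral.integral_add_adjacent_intervals
        (hii _ hSd 0 h0 _ ha) (hii _ hSd _ ha _ hb), ← intervalIntegral.integral_add_adjacent_intervals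
        (hii _ hdg.abs 0 h0 _ ha) (hii _ hdg.abs _ ha _ hb), mul_add]
      refine le_trans (le_of_eq ?_) ((abs_add_le _ _).trans (add_le_add h1 h2))
      congr 1; ring
  intro t ht
  set n := ⌊(m : ℝ) * t / T⌋₊ with hn
  have hX : Xi T m t = (n : ℝ) * T / m := by unfold Xi; rw [← hn]; ring
  have hn1 : (n : ℝ) ≤ m * t / T := Nat.floor_le (by have := ht.1; positivity)
  have hn2 : m * t / T < n + 1 := Nat.lt_floor_add_one _
  have hXt : (n : ℝ) * T / m ≤ t := by
    rw [div_le_iff₀ hm']; rw [le_div_iff₀ hT] at hn1; linarith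
  have hXt2 : t - (n : ℝ) * T / m ≤ T / m := by
    rw [div_lt_iff₀ hT] at hn2
    rw [← sub_nonneg]
    have : T / m - (t - (n : ℝ) * T / m) = ((n + 1) * T - m * t) / m := by field_simp; ring
    rw [this]
    apply div_nonneg _ hm'.le; linarith
  have ha : (n : ℝ) * T / m ∈ Icc (0:ℝ) T := ⟨by positivity, hXt.trans ht.2⟩
  rw [hX, hconv _ _ ht.1]
  have h1 := hgrid n ha.2
  have h2 := hstep _ ha t ht hXt hXt2
  have h3 : η * ∫ s in (0:ℝ)..t, |dg s| ≤ η * ∫ s in Icc (0:ℝ) T, |dg s| := by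
    rw [← hconv _ _ ht.1]
    apply mul_le_mul_of_nonneg_left _ hη0
    exact setIntegral_mono_set hdg.abs (.of_forall fun s => abs_nonneg _)
      (Icc_subset_Icc_right ht.2).eventuallyLE
  refine le_trans ?_ h3
  rw [← intervalIntegral.integral_add_adjacent_intervals
        (hii _ hSd 0 h0 _ ha) (hii _ hSd _ ha _ ht), ← intervalIntegral.integral_add_adjacent_intervals
        (hii _ hdg.abs 0 h0 _ ha) (hii _ hdg.abs _ ha _ ht), mul_add]
  refine le_trans (le_of_eq ?_) ((abs_add_le _ _).trans (add_le_add h1 h2))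
  congr 1; ring

/-- uniform (in time and on energy sub-level sets) convergence of the
pathwise discretizations `Φ_m` to `Φ`. -/
theorem PhimPath_uniform_approximation
    (T : ℝ) (hT : 0 < T) (ρ : ℝ) (hρ : ρ ∈ Ioo (-1:ℝ) 1)
    (K : ℝ → ℝ → ℝ) (c cr : ℝ) (hc : 0 < c) (hcr : 0 < cr)
    (hKmeas : Measurable (Function.uncurry K))
    (hKint : ∀ t ∈ Icc (0:ℝ) T, IntegrableOn (fun s => (K t s)^2) (Icc (0:ℝ) T))
    (CK : ℝ) (hKbdd : ∀ t ∈ Icc (0:ℝ) T, (∫ s in Icc (0:ℝ) T, (K t s)^2) ≤ CK)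
    (hKmoc : ∀ t₁ ∈ Icc (0:ℝ) T, ∀ t₂ ∈ Icc (0:ℝ) T,
      (∫ s in Icc (0:ℝ) T, (K t₁ s - K t₂ s)^2) ≤ c * |t₁ - t₂| ^ cr)
    (hKvolterra : ∀ t s : ℝ, 0 ≤ t → t < s → s ≤ T → K t s = 0)
    (U : ℝ → ℝ) (hUcont : Continuous U) (hUnonneg : ∀ x, 0 ≤ U x)
    (σ : ℝ → ℝ) (hσcont : Continuous σ) (hσpos : ∀ x, 0 < σ x)
    (v₀ : ℝ) (hv₀ : 0 < v₀) (μ : ℝ) (hμ : 0 < μ)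
    (bb sb : ℝ → ℝ)
    (hbgrow : ∀ x : ℝ, (bb x)^2 ≤ μ^2 * (1 + x^2))
    (hsgrow : ∀ x : ℝ, (sb x)^2 ≤ μ^2 * (1 + x^2))
    (hblip : LocallyLipschitz bb) (hb0 : 0 < bb 0)
    (hsnonneg : ∀ x : ℝ, 0 ≤ sb x)
    (hslip : ∀ x : ℝ, x ≠ 0 → ∃ u ∈ nhds x, ∃ L : NNReal, LipschitzOnWith L sb u)
    (hs0 : sb 0 = 0) (hspos : ∀ x : ℝ, x ≠ 0 → 0 < sb x)
    (γ : ℝ → ℝ) (hγcont : ContinuousOn γ (Ioi (0:ℝ)))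
    (hγmono : MonotoneOn γ (Ioi (0:ℝ)))
    (hγpos : ∀ u : ℝ, 0 < u → 0 < γ u)
    (hγint : ∀ ε : ℝ, 0 < ε → ¬ IntegrableOn (fun u => 1 / (γ u)^2) (Ioc (0:ℝ) ε))
    (hγbound : ∀ x y : ℝ, x ≠ y → |sb x - sb y| ≤ γ |x - y|)
    (ζ : ℝ) (hζ : 0 < ζ) :
    ∀ ε : ℝ, 0 < ε → ∃ N : ℕ, ∀ m : ℕ, N ≤ m →
      ∀ (r f dr df v : ℝ → ℝ),
        Measurable dr → IntegrableOn (fun s => (dr s)^2) (Icc (0:ℝ) T) →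
        (∀ t ∈ Icc (0:ℝ) T, r t = ∫ s in Icc (0:ℝ) t, dr s) →
        Measurable df → IntegrableOn (fun s => (df s)^2) (Icc (0:ℝ) T) →
        (∀ t ∈ Icc (0:ℝ) T, f t = ∫ s in Icc (0:ℝ) t, df s) →
        ContinuousOn v (Icc (0:ℝ) T) →
        (∀ t ∈ Icc (0:ℝ) T,
          v t = v₀ + (∫ s in Icc (0:ℝ) t, bb (v s)) + ∫ s in Icc (0:ℝ) t, sb (v s) * df s) →
        (1/2) * (∫ s in Icc (0:ℝ) T, (dr s)^2) + (1/2) * (∫ s in Icc (0:ℝ) T, (df s)^2) ≤ ζ →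
        ∀ t ∈ Icc (0:ℝ) T,
          |PhiPath ρ K U σ dr df v t - PhimPath T ρ K U σ m r f v t| ≤ ε := by
  obtain ⟨C, hC0, hC⟩ := aux_apriori T hT v₀ μ ζ hζ bb sb hbgrow hsgrow
  obtain ⟨M, hM⟩ := (isCompact_Icc (a := -C) (b := C)).exists_bound_of_continuousOn
    hUcont.continuousOn
  set W := Real.sqrt (CK * (M^2 * T))
  intro ε hε
  set η := ε / (T + 2 * ζ)
  have hη : 0 < η := by positivity
  have huc := (isCompact_Icc (a := -W) (b := W)).uniformContinuousOn_of_continuous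
    hσcont.continuousOn
  obtain ⟨δ, hδ, hσδ⟩ := Metric.uniformContinuousOn_iff.1 huc η hη
  -- modulus of continuity tends to zero
  have hlim : Filter.Tendsto (fun x : ℝ => c * |x| ^ cr * (M^2 * T)) (nhds 0) (nhds 0) := by
    have : Continuous (fun x : ℝ => c * |x| ^ cr * (M^2 * T)) :=
      ((continuous_const.mul (continuous_abs.rpow_const fun _ => Or.inr hcr.le))).mul
        continuous_const
    simpa [Real.zero_rpow hcr.ne'] using this.tendsto 0
  obtain ⟨h, hh, hhδ⟩ := Metric.eventually_nhds_iff.1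
    (hlim.eventually_lt_const (show (0:ℝ) < δ^2 by positivity))
  obtain ⟨N, hN⟩ := exists_nat_gt (T / h)
  refine ⟨N + 1, ?_⟩
  intro m hm r f dr df v hdr hdr2 hr hdf hdf2 hf hv heq hen
  have hm0 : 0 < m := by omega
  have hmR : (0:ℝ) < m := by exact_mod_cast hm0
  have hTm : T / m < h := by
    have : (N : ℝ) ≤ m := by exact_mod_cast (by omega : N ≤ m)
    rw [div_lt_iff₀ hmR]
    rw [div_lt_iff₀ hh] at hN
    nlinarith
  have hr0 : 0 ≤ ∫ s in Icc (0:ℝ) T, (dr s)^2 := integral_nonneg fun s => sq_nonneg _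
  have hf0 : 0 ≤ ∫ s in Icc (0:ℝ) T, (df s)^2 := integral_nonneg fun s => sq_nonneg _
  have hvC := hC df v hdf hdf2 hv heq (by linarith)
  obtain ⟨hw1, hw2⟩ := aux_w T hT K c cr hKmeas hKint CK hKbdd hKmoc hKvolterra U hUcont v hv M
    (fun s hs => hM _ (abs_le.1 (hvC s hs)))
  have hwW : ∀ t ∈ Icc (0:ℝ) T, what K U v t ∈ Icc (-W) W := fun t ht =>
    abs_le.1 (Real.abs_le_sqrt (hw1 t ht))
  have hclose : ∀ a ∈ Icc (0:ℝ) T, ∀ b ∈ Icc (0:ℝ) T, |a - b| < h →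
      |what K U v a - what K U v b| < δ := by
    intro a ha b hb hab
    apply abs_lt_of_sq_lt_sq _ hδ.le
    exact (hw2 a ha b hb).trans_lt (hhδ (by simpa using hab))
  have hwc : ContinuousOn (what K U v) (Icc (0:ℝ) T) := by
    intro a ha
    have h1 : Filter.Tendsto (fun x : ℝ => c * |x - a| ^ cr * (M^2 * T)) (nhdsWithin a (Icc 0 T))
        (nhds 0) := by
      refine hlim.comp ?_
      have : Continuous fun x : ℝ => x - a := by fun_prop
      simpa using (this.tendsto a).mono_left nhdsWithin_le_nhds
    have h2 := (Real.continuous_sqrt.tendsto 0).comp h1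
    rw [Real.sqrt_zero] at h2
    refine tendsto_iff_dist_tendsto_zero.2 (squeeze_zero' (.of_forall fun _ => dist_nonneg) ?_ h2)
    filter_upwards [self_mem_nhdsWithin] with x hx
    exact Real.abs_le_sqrt (hw2 x hx a ha)
  have hL1 : ∀ g : ℝ → ℝ, Measurable g → IntegrableOn (fun s => (g s)^2) (Icc (0:ℝ) T) →
      (∫ s in Icc (0:ℝ) T, (g s)^2) ≤ 2 * ζ →
      IntegrableOn g (Icc (0:ℝ) T) ∧ (∫ s in Icc (0:ℝ) T, |g s|) ≤ (T + 2 * ζ) / 2 := by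
    intro g hg hg2 hge
    have hgL : MemLp g 2 (volume.restrict (Icc (0:ℝ) T)) := by
      rw [memLp_two_iff_integrable_sq hg.aestronglyMeasurable]; exact hg2
    have hgi : IntegrableOn g (Icc (0:ℝ) T) := hgL.integrable (by norm_num)
    refine ⟨hgi, ?_⟩
    have hb : IntegrableOn (fun s => (1 + (g s)^2) / 2) (Icc (0:ℝ) T) :=
      ((integrable_const (1:ℝ)).add hg2).div_const 2
    refine (integral_mono hgi.abs hb fun s => ?_).trans ?_
    · have := sq_nonneg (|g s| - 1)
      have h2 := sq_abs (g s)
      simp only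
      nlinarith
    · rw [integral_div, integral_add (integrable_const _) hg2]
      simp [hT.le]
      linarith
  have hS : ContinuousOn (fun t => σ (what K U v t)) (Icc (0:ℝ) T) :=
    hσcont.comp_continuousOn hwc
  have hSη : ∀ a ∈ Icc (0:ℝ) T, ∀ b ∈ Icc (0:ℝ) T, |a - b| ≤ T / m →
      |σ (what K U v a) - σ (what K U v b)| ≤ η := fun a ha b hb hab =>
    (hσδ _ (hwW a ha) _ (hwW b hb) (hclose a ha b hb (hab.trans_lt hTm))).le
  obtain ⟨hri, hrb⟩ := hL1 dr hdr hdr2 (by linarith)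
  obtain ⟨hfi, hfb⟩ := hL1 df hdf hdf2 (by linarith)
  intro t ht
  have e1 := (aux_riemann T hT m hm0 _ r dr η hS hSη hri hr t ht).trans
    (mul_le_mul_of_nonneg_left hrb hη.le)
  have e2 := (aux_riemann T hT m hm0 _ f df η hS hSη hfi hf t ht).trans
    (mul_le_mul_of_nonneg_left hfb hη.le)
  have e3 : η * ((T + 2 * ζ) / 2) = ε / 2 := by
    simp only [η]; field_simp
  rw [e3] at e1 e2
  have hρ1 : |ρ| ≤ 1 := abs_le.2 ⟨hρ.1.le, hρ.2.le⟩
  have hρ2 : |Real.sqrt (1 - ρ^2)| ≤ 1 := by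
    rw [abs_of_nonneg (Real.sqrt_nonneg _)]
    exact Real.sqrt_le_one.2 (by nlinarith [sq_nonneg ρ])
  unfold PhiPath PhimPath
  have key : ∀ p q A B A' B' : ℝ, |p| ≤ 1 → |q| ≤ 1 → |A - A'| ≤ ε / 2 → |B - B'| ≤ ε / 2 →
      |p * A + q * B - (p * A' + q * B')| ≤ ε := by
    intro p q A B A' B' hp hq hA hB
    have : p * A + q * B - (p * A' + q * B') = p * (A - A') + q * (B - B') := by ring
    rw [this]
    refine (abs_add_le _ _).trans ?_
    rw [abs_mul, abs_mul]
    nlinarith [mul_le_mul hp hA (abs_nonneg _) zero_le_one,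
      mul_le_mul hq hB (abs_nonneg _) zero_le_one]
  exact key _ _ _ _ _ _ hρ2 hρ1 e1 e2
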